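/- arXiv:2203.15308 — 7 statements merged into one kernel-verified Lean document; each statement's English description precedes it below -/
import Mathlib

section
/- Let Y be an integrable real random variable, T a {0,1}-valued random variable, and Z a random element such that Y is conditionally independent of T given Z. Let e(Z) := E[T | Z] and assume e(Z) > 0 almost surely. Then for every measurable function g such that g(Y, Z) and T·g(Y, Z)/e(Z) are integrable, E[T · g(Y, Z) / e(Z)] = E[g(Y, Z)]. -/
open MeasureTheory ProbabilityTheory
open scoped BigOperators

/-- Let `Y` be an integrable real random variable, `T` a `{0,1}`-valued random
variable, and `Z` a random element such that `Y` is conditionally independent of `T` given `Z`.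
Let `e(Z) := E[T | Z]` and assume `e(Z) > 0` almost surely.  Then for every measurable function
`g` such that `g(Y, Z)` and `T·g(Y, Z)/e(Z)` are integrable,
`E[T · g(Y, Z) / e(Z)] = E[g(Y, Z)]`. -/
theorem stmt1
    {Ω : Type*} [MeasurableSpace Ω] [StandardBorelSpace Ω] [Nonempty Ω]
    {μ : Measure Ω} [IsProbabilityMeasure μ]
    {𝒵 : Type*} [MeasurableSpace 𝒵]
    (Y : Ω → ℝ) (T : Ω → ℝ) (Z : Ω → 𝒵)
    (hYmeas : Measurable Y) (hTmeas : Measurable T) (hZmeas : Measurable Z)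
    (hYint : Integrable Y μ)
    (hT01 : ∀ ω, T ω = 0 ∨ T ω = 1)
    (hCI : CondIndepFun (MeasurableSpace.comap Z inferInstance) (hZmeas.comap_le) Y T μ)
    (hepos : ∀ᵐ ω ∂μ, 0 < (μ[T | MeasurableSpace.comap Z inferInstance]) ω)
    (g : ℝ → 𝒵 → ℝ) (hgmeas : Measurable (Function.uncurry g))
    (hgint : Integrable (fun ω => g (Y ω) (Z ω)) μ)
    (hTgint : Integrable
      (fun ω => T ω * g (Y ω) (Z ω) / (μ[T | MeasurableSpace.comap Z inferInstance]) ω) μ) :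
    ∫ ω, T ω * g (Y ω) (Z ω) / (μ[T | MeasurableSpace.comap Z inferInstance]) ω ∂μ
      = ∫ ω, g (Y ω) (Z ω) ∂μ := by
  have hm := hZmeas.comap_le
  have hTint : Integrable T μ := by
    refine Integrable.of_bound hTmeas.aestronglyMeasurable 1 (ae_of_all _ fun ω => ?_)
    rcases hT01 ω with h | h <;> simp [h]
  have hT0 : ∀ ω, 0 ≤ T ω := fun ω => by rcases hT01 ω with h | h <;> simp [h]
  have hTind : (T ⁻¹' {1}).indicator (fun _ => (1 : ℝ)) = T := by
    funext ω
    rcases hT01 ω with h | h <;> simp [h]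
  obtain ⟨h, hh, heq⟩ := (stronglyMeasurable_condExp (μ := μ) (f := T)
    (m := MeasurableSpace.comap Z inferInstance)).measurable.exists_eq_measurable_comp
  have heint : Integrable (μ[T | MeasurableSpace.comap Z inferInstance]) μ := integrable_condExp
  have hesm : StronglyMeasurable[MeasurableSpace.comap Z inferInstance]
    (μ[T | MeasurableSpace.comap Z inferInstance]) := stronglyMeasurable_condExp
  have hpull : ∀ s : Set ℝ, MeasurableSet s →
      μ[(Y ⁻¹' s).indicator T | MeasurableSpace.comap Z inferInstance] =ᵐ[μ]
      μ[(Y ⁻¹' s).indicator (μ[T | MeasurableSpace.comap Z inferInstance])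
        | MeasurableSpace.comap Z inferInstance] := by
    intro s hs
    have h1 := (condIndepFun_iff_condExp_inter_preimage_eq_mul hYmeas hTmeas).1 hCI s {1} hs
      (measurableSet_singleton 1)
    rw [hTind, ← Set.indicator_indicator, hTind] at h1
    have hind : ((Y ⁻¹' s).indicator (fun _ => (1 : ℝ))) *
        (μ[T | MeasurableSpace.comap Z inferInstance]) =
        (Y ⁻¹' s).indicator (μ[T | MeasurableSpace.comap Z inferInstance]) := by
      funext ω
      by_cases hω : ω ∈ Y ⁻¹' s <;> simp [hω]
    have h2 := condExp_mul_of_stronglyMeasurable_right (μ := μ)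
      (f := (Y ⁻¹' s).indicator (fun _ => (1 : ℝ))) hesm
      (by rw [hind]; exact heint.indicator (hYmeas hs))
      ((integrable_const (1 : ℝ)).indicator (hYmeas hs))
    rw [hind] at h2
    exact h1.trans h2.symm
  rw [heq] at hepos heint hpull ⊢
  have hYZ : Measurable (fun ω => (Y ω, Z ω)) := hYmeas.prodMk hZmeas
  have hmT : Measurable (fun ω => ENNReal.ofReal (T ω)) := hTmeas.ennreal_ofReal
  have hme : Measurable (fun ω => ENNReal.ofReal ((h ∘ Z) ω)) := (hh.comp hZmeas).ennreal_ofReal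
  have f1 := isFiniteMeasure_withDensity_ofReal hTint.2
  have f2 := isFiniteMeasure_withDensity_ofReal heint.2
  have hmeas : (μ.withDensity fun ω => ENNReal.ofReal (T ω)).map (fun ω => (Y ω, Z ω)) =
      (μ.withDensity fun ω => ENNReal.ofReal ((h ∘ Z) ω)).map (fun ω => (Y ω, Z ω)) := by
    refine Measure.ext_prod fun {s t} hs ht => ?_
    rw [Measure.map_apply hYZ (hs.prod ht), Measure.map_apply hYZ (hs.prod ht)]
    have hpre : (fun ω => (Y ω, Z ω)) ⁻¹' (s ×ˢ t) = Z ⁻¹' t ∩ Y ⁻¹' s := by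
      ext ω; simp [and_comm]
    have hst := (hZmeas ht).inter (hYmeas hs)
    have htm : MeasurableSet[MeasurableSpace.comap Z inferInstance] (Z ⁻¹' t) := ⟨t, ht, rfl⟩
    rw [hpre, withDensity_apply _ hst, withDensity_apply _ hst,
      ← ofReal_integral_eq_lintegral_ofReal hTint.integrableOn (ae_of_all _ hT0),
      ← ofReal_integral_eq_lintegral_ofReal heint.integrableOn
        (ae_restrict_of_ae (hepos.mono fun _ hx => hx.le))]
    congr 1
    rw [← setIntegral_indicator (hYmeas hs), ← setIntegral_indicator (hYmeas hs),
      ← setIntegral_condExp hm (hTint.indicator (hYmeas hs)) htm,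
      ← setIntegral_condExp hm (heint.indicator (hYmeas hs)) htm]
    exact integral_congr_ae (ae_restrict_of_ae (hpull s hs))
  have hF : Measurable (fun p : ℝ × 𝒵 => Function.uncurry g p / h p.2) :=
    hgmeas.div (hh.comp measurable_snd)
  have key := congrArg (fun ν => ∫ p, Function.uncurry g p / h p.2 ∂ν) hmeas
  rw [integral_map hYZ.aemeasurable hF.aestronglyMeasurable,
    integral_map hYZ.aemeasurable hF.aestronglyMeasurable,
    integral_withDensity_eq_integral_toReal_smul hmT (by simp),
    integral_withDensity_eq_integral_toReal_smul hme (by simp)] at key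
  calc _ = _ := integral_congr_ae (ae_of_all _ fun ω => by
        simp [ENNReal.toReal_ofReal (hT0 ω), mul_div_assoc])
    _ = _ := key
    _ = _ := integral_congr_ae (hepos.mono fun ω hω => by
        have hω' : 0 < h (Z ω) := hω
        simp only [Function.comp, ENNReal.toReal_ofReal hω'.le, Function.uncurry, smul_eq_mul]
        field_simp)
end

section
/- (Double robustness of the augmented inverse-probability-weighted functional.) Let Y be an integrable real random variable, T a {0,1}-valued random variable, and Z a random element with Y conditionally independent of T given Z; set e(Z) := E[T | Z] and assume e(Z) > 0 almost surely. Let ẽ be a measurable function with 0 < ẽ(Z) ≤ 1 almost surely (a working propensity model) and let m̃ be a measurable function with m̃(Z) integrable (a working outcome model), and assume T·Y/ẽ(Z) and T·m̃(Z)/ẽ(Z) are integrable. If either ẽ(Z) = e(Z) almost surely, or m̃(Z) = E[Y | Z] almost surely, then E[(T/ẽ(Z))·Y + (1 − T/ẽ(Z))·m̃(Z)] = E[Y]. -/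
open MeasureTheory ProbabilityTheory
open scoped BigOperators

theorem condExp_mul_of_condIndepFun_aux
    {Ω : Type*} {m : MeasurableSpace Ω} [mΩ : MeasurableSpace Ω] [StandardBorelSpace Ω] [Nonempty Ω]
    {μ : Measure Ω} [IsProbabilityMeasure μ] (hm : m ≤ mΩ)
    (Y : Ω → ℝ) (T : Ω → ℝ) (hY : Measurable Y) (hT : Measurable T)
    (hYi : Integrable Y μ) (hTi : Integrable T μ) (hTY : Integrable (T * Y) μ)
    (h : CondIndepFun m hm Y T μ) :
    μ[T * Y | m] =ᵐ[μ] μ[T | m] * μ[Y | m] := by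
  have h1 := ae_of_ae_trim hm ((condIndepFun_iff_map_prod_eq_prod_map_map hY hT).1 h)
  filter_upwards [h1, condExp_ae_eq_integral_condExpKernel hm hTY,
    condExp_ae_eq_integral_condExpKernel hm hTi,
    condExp_ae_eq_integral_condExpKernel hm hYi] with ω h1 h2 h3 h4
  rw [Pi.mul_apply, h2, h3, h4]
  have hi : IndepFun Y T (condExpKernel μ m ω) := by
    rw [indepFun_iff_map_prod_eq_prod_map_map hY.aemeasurable hT.aemeasurable]
    rwa [Kernel.map_apply _ (hY.prodMk hT), Kernel.prod_apply, Kernel.map_apply _ hY,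
      Kernel.map_apply _ hT] at h1
  exact hi.symm.integral_mul_eq_mul_integral hT.aestronglyMeasurable hY.aestronglyMeasurable

/-- (Double robustness of the augmented inverse-probability-weighted functional.)
If either the working propensity model `ẽ` is correct or the working outcome model `m̃` is
correct, then `E[(T/ẽ(Z))·Y + (1 − T/ẽ(Z))·m̃(Z)] = E[Y]`. -/
theorem stmt3
    {Ω : Type*} [MeasurableSpace Ω] [StandardBorelSpace Ω] [Nonempty Ω]
    {μ : Measure Ω} [IsProbabilityMeasure μ]
    {𝒵 : Type*} [MeasurableSpace 𝒵]
    (Y : Ω → ℝ) (T : Ω → ℝ) (Z : Ω → 𝒵)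
    (hYmeas : Measurable Y) (hTmeas : Measurable T) (hZmeas : Measurable Z)
    (hYint : Integrable Y μ)
    (hT01 : ∀ ω, T ω = 0 ∨ T ω = 1)
    (hCI : CondIndepFun (MeasurableSpace.comap Z inferInstance) (hZmeas.comap_le) Y T μ)
    (hepos : ∀ᵐ ω ∂μ, 0 < (μ[T | MeasurableSpace.comap Z inferInstance]) ω)
    -- working propensity model
    (etil : 𝒵 → ℝ) (hetilmeas : Measurable etil)
    (hetil01 : ∀ᵐ ω ∂μ, 0 < etil (Z ω) ∧ etil (Z ω) ≤ 1)
    -- working outcome model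
    (mtil : 𝒵 → ℝ) (hmtilmeas : Measurable mtil)
    (hmtilint : Integrable (fun ω => mtil (Z ω)) μ)
    -- integrability of the displayed quantities
    (hTYint : Integrable (fun ω => T ω * Y ω / etil (Z ω)) μ)
    (hTmint : Integrable (fun ω => T ω * mtil (Z ω) / etil (Z ω)) μ)
    -- at least one of the two working models is correctly specified
    (hdr : (∀ᵐ ω ∂μ, etil (Z ω) = (μ[T | MeasurableSpace.comap Z inferInstance]) ω)
      ∨ ((fun ω => mtil (Z ω)) =ᵐ[μ] μ[Y | MeasurableSpace.comap Z inferInstance])) :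
    ∫ ω, ((T ω / etil (Z ω)) * Y ω + (1 - T ω / etil (Z ω)) * mtil (Z ω)) ∂μ
      = ∫ ω, Y ω ∂μ := by
  have hm := hZmeas.comap_le
  have hZm : Measurable[MeasurableSpace.comap Z inferInstance] Z := comap_measurable Z
  have hg : StronglyMeasurable[MeasurableSpace.comap Z inferInstance]
      (fun ω => (etil (Z ω))⁻¹) := ((hetilmeas.comp hZm).inv).stronglyMeasurable
  have hmt : StronglyMeasurable[MeasurableSpace.comap Z inferInstance]
      (fun ω => mtil (Z ω)) := (hmtilmeas.comp hZm).stronglyMeasurable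
  have hTb : ∀ ω, ‖T ω‖ ≤ 1 := fun ω => by rcases hT01 ω with h | h <;> simp [h]
  have hTi : Integrable T μ :=
    Integrable.of_bound hTmeas.aestronglyMeasurable 1 (Filter.Eventually.of_forall hTb)
  have hTY : Integrable (T * Y) μ :=
    hYint.bdd_mul hTmeas.aestronglyMeasurable (Filter.Eventually.of_forall hTb)
  have hA : Integrable ((fun ω => (etil (Z ω))⁻¹) * (T * Y)) μ := by
    refine hTYint.congr (Filter.Eventually.of_forall fun ω => ?_)
    simp only [Pi.mul_apply]; ring
  have hB : Integrable (((fun ω => (etil (Z ω))⁻¹) * (fun ω => mtil (Z ω))) * T) μ := by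
    refine hTmint.congr (Filter.Eventually.of_forall fun ω => ?_)
    simp only [Pi.mul_apply]; ring
  have e0 := condExp_mul_of_condIndepFun_aux hm Y T hYmeas hTmeas hYint hTi hTY hCI
  have e1 := condExp_mul_of_stronglyMeasurable_left hg hA hTY
  have e2 := condExp_mul_of_stronglyMeasurable_left (hg.mul hmt) hB hTi
  have key : μ[(fun ω => (etil (Z ω))⁻¹) * (T * Y)
      | MeasurableSpace.comap Z inferInstance] - μ[((fun ω => (etil (Z ω))⁻¹) *
        (fun ω => mtil (Z ω))) * T | MeasurableSpace.comap Z inferInstance]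
      =ᵐ[μ] μ[Y | MeasurableSpace.comap Z inferInstance] - (fun ω => mtil (Z ω)) := by
    rcases hdr with h | h
    · filter_upwards [e0, e1, e2, h, hepos] with ω e0 e1 e2 h hp
      simp only [Pi.sub_apply, Pi.mul_apply] at *
      rw [e1, e2, e0, h]
      field_simp
    · filter_upwards [e0, e1, e2, h] with ω e0 e1 e2 h
      simp only [Pi.sub_apply, Pi.mul_apply] at *
      rw [e1, e2, e0, h]
      ring
  have hint := integral_congr_ae key
  rw [integral_sub' integrable_condExp integrable_condExp, integral_condExp hm,
    integral_condExp hm, integral_sub' integrable_condExp hmtilint, integral_condExp hm] at hint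
  have hsplit : ∀ ω, (T ω / etil (Z ω)) * Y ω + (1 - T ω / etil (Z ω)) * mtil (Z ω)
      = (((fun ω => (etil (Z ω))⁻¹) * (T * Y)) -
        (((fun ω => (etil (Z ω))⁻¹) * (fun ω => mtil (Z ω))) * T)) ω + mtil (Z ω) := by
    intro ω
    simp only [Pi.sub_apply, Pi.mul_apply]; ring
  simp_rw [hsplit]
  rw [integral_add (hA.sub hB) hmtilint, integral_sub' hA hB]
  linarith
end

section
/- (Conditional Stein identity.) Let σ > 0, let ε be a real random variable with law N(0, σ²), and let W be a random element of a measurable space 𝒲 independent of ε. Let g : 𝒲 × ℝ → ℝ be measurable such that for every w ∈ 𝒲 the function e ↦ g(w, e) is differentiable with derivative ∂₂g(w, e), and assume E|ε · g(W, ε)| < ∞ and E|∂₂g(W, ε)| < ∞. Then E[ε · g(W, ε)] = σ² · E[∂₂g(W, ε)]. -/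
open MeasureTheory ProbabilityTheory
open scoped BigOperators

open scoped NNReal Topology

lemma stein_pdf_deriv (v : ℝ≥0) (hv : v ≠ 0) (x : ℝ) :
    HasDerivAt (gaussianPDFReal 0 v) (-(x / v) * gaussianPDFReal 0 v x) x := by
  have hv' : (v : ℝ) ≠ 0 := by exact_mod_cast hv
  rw [gaussianPDFReal_def]
  have h1 : HasDerivAt (fun x : ℝ => -(x - 0) ^ 2 / (2 * (v : ℝ))) (-(x / v)) x := by
    have := ((((hasDerivAt_id x).sub_const 0).pow 2).neg).div_const (2 * (v : ℝ))
    refine this.congr_deriv ?_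
    simp
    field_simp
  refine ((h1.exp).const_mul ((√(2 * Real.pi * v))⁻¹)).congr_deriv ?_
  ring

lemma stein_one (v : ℝ≥0) (hv : v ≠ 0) (f f' : ℝ → ℝ)
    (hf : ∀ x, HasDerivAt f (f' x) x)
    (h1 : Integrable (fun x => x * f x) (gaussianReal 0 v))
    (h2 : Integrable f' (gaussianReal 0 v)) :
    ∫ x, x * f x ∂(gaussianReal 0 v) = v * ∫ x, f' x ∂(gaussianReal 0 v) := by
  have hv' : (v : ℝ) ≠ 0 := by exact_mod_cast hv
  have hc : Continuous f := continuous_iff_continuousAt.2 fun x => (hf x).continuousAt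
  have h0 : Integrable f (gaussianReal 0 v) := by
    obtain ⟨M, hM⟩ := (isCompact_Icc (a := (-1 : ℝ)) (b := 1)).exists_bound_of_continuousOn
      hc.continuousOn
    refine ((integrable_const M).add h1.norm).mono' hc.aestronglyMeasurable
      (Filter.Eventually.of_forall fun x => ?_)
    have hM0 : 0 ≤ M := (norm_nonneg _).trans (hM 0 (by simp))
    simp only [Pi.add_apply, norm_mul]
    by_cases hx : x ∈ Set.Icc (-1 : ℝ) 1
    · have := hM x hx
      have : 0 ≤ ‖x‖ * ‖f x‖ := by positivity
      linarith
    · have : 1 ≤ ‖x‖ := by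
        rw [Set.mem_Icc, ← abs_le] at hx
        exact (not_le.1 hx).le
      nlinarith [norm_nonneg (f x)]
  have key : ∀ h : ℝ → ℝ, Integrable h (gaussianReal 0 v) →
      Integrable (fun x => gaussianPDFReal 0 v x * h x) := by
    intro h hh
    rw [gaussianReal_of_var_ne_zero _ hv, integrable_withDensity_iff_integrable_smul'
      (measurable_gaussianPDF _ _) (ae_of_all _ fun _ => gaussianPDF_lt_top)] at hh
    simpa [toReal_gaussianPDF] using hh
  have ibp := integral_mul_deriv_eq_deriv_mul_of_integrable (u := f) (u' := f')
    (v := gaussianPDFReal 0 v) (v' := fun x => -(x / v) * gaussianPDFReal 0 v x)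
    (fun x _ => hf x) (fun x _ => stein_pdf_deriv v hv x)
    (by
      refine Integrable.congr ((key _ h1).const_mul (-(v : ℝ)⁻¹)) (ae_of_all _ fun x => ?_)
      simp only [Pi.mul_apply]; ring)
    (by
      refine Integrable.congr (key _ h2) (ae_of_all _ fun x => ?_)
      simp only [Pi.mul_apply]; ring)
    (by
      refine Integrable.congr (key _ h0) (ae_of_all _ fun x => ?_)
      simp only [Pi.mul_apply]; ring)
  rw [integral_gaussianReal_eq_integral_smul hv, integral_gaussianReal_eq_integral_smul hv]
  have e1 : ∫ x, f x * (-(x / v) * gaussianPDFReal 0 v x)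
      = -(v : ℝ)⁻¹ * ∫ x, gaussianPDFReal 0 v x • (x * f x) := by
    rw [← integral_const_mul]
    congr 1; ext x; simp only [smul_eq_mul]; ring
  have e2 : ∫ x, f' x * gaussianPDFReal 0 v x = ∫ x, gaussianPDFReal 0 v x • f' x := by
    congr 1; ext x; simp only [smul_eq_mul]; ring
  rw [e1, e2] at ibp
  rw [← neg_neg (∫ x, gaussianPDFReal 0 v x • f' x), ← ibp]
  field_simp

lemma stein_meas {S : Type*} [MeasurableSpace S] (g g' : S × ℝ → ℝ) (hg : Measurable g)
    (hderiv : ∀ (w : S) (e : ℝ), HasDerivAt (fun s => g (w, s)) (g' (w, e)) e) :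
    Measurable g' := by
  refine measurable_of_tendsto_metrizable' (𝓝[≠] (0 : ℝ))
    (f := fun t p => t⁻¹ • (g (p.1, p.2 + t) - g p)) (fun t => ?_) ?_
  · have : Measurable fun p : S × ℝ => g (p.1, p.2 + t) := hg.comp (by fun_prop)
    exact (this.sub hg).const_smul (t⁻¹)
  · rw [tendsto_pi_nhds]
    exact fun p => (hderiv p.1 p.2).tendsto_slope_zero

/-- (Conditional Stein identity.) Let `σ > 0`, let `ε ~ N(0, σ²)` and let `W` be
a random element of a measurable space `𝒲` independent of `ε`.  Let `g : 𝒲 × ℝ → ℝ` be measurable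
and differentiable in its second argument with derivative `g'`, with `ε·g(W,ε)` and `g'(W,ε)`
integrable.  Then `E[ε · g(W, ε)] = σ² · E[g'(W, ε)]`. -/
theorem stmt4
    {Ω : Type*} [MeasurableSpace Ω] {μ : Measure Ω} [IsProbabilityMeasure μ]
    {𝒲 : Type*} [MeasurableSpace 𝒲]
    (σ : ℝ) (hσ : 0 < σ)
    (ε : Ω → ℝ) (W : Ω → 𝒲)
    (hεmeas : Measurable ε) (hWmeas : Measurable W)
    (hεlaw : Measure.map ε μ = gaussianReal 0 ⟨σ ^ 2, sq_nonneg σ⟩)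
    (hindep : IndepFun ε W μ)
    (g g' : 𝒲 × ℝ → ℝ)
    (hgmeas : Measurable g)
    (hderiv : ∀ (w : 𝒲) (e : ℝ), HasDerivAt (fun s => g (w, s)) (g' (w, e)) e)
    (hint1 : Integrable (fun ω => ε ω * g (W ω, ε ω)) μ)
    (hint2 : Integrable (fun ω => g' (W ω, ε ω)) μ) :
    ∫ ω, ε ω * g (W ω, ε ω) ∂μ = σ ^ 2 * ∫ ω, g' (W ω, ε ω) ∂μ := by
  have hg' : Measurable g' := stein_meas g g' hgmeas hderiv
  have hm1 : Measurable fun p : 𝒲 × ℝ => p.2 * g p := measurable_snd.mul hgmeas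
  have hp : Measurable fun ω => (W ω, ε ω) := hWmeas.prodMk hεmeas
  have hmap := hindep.symm.map_prod_eq_prod_map_map hWmeas.aemeasurable hεmeas.aemeasurable
  set v : ℝ≥0 := ⟨σ ^ 2, sq_nonneg σ⟩ with hvdef
  have hvc : (v : ℝ) = σ ^ 2 := rfl
  have hv : v ≠ 0 := by
    intro h
    have : (v : ℝ) = 0 := by rw [h]; rfl
    rw [hvc] at this
    exact (pow_pos hσ 2).ne' this
  rw [hεlaw] at hmap
  have : IsProbabilityMeasure (μ.map W) := Measure.isProbabilityMeasure_map hWmeas.aemeasurable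
  have i1 : Integrable (fun p : 𝒲 × ℝ => p.2 * g p) ((μ.map W).prod (gaussianReal 0 v)) := by
    rw [← hmap, integrable_map_measure hm1.aestronglyMeasurable hp.aemeasurable]
    exact hint1
  have i2 : Integrable g' ((μ.map W).prod (gaussianReal 0 v)) := by
    rw [← hmap, integrable_map_measure hg'.aestronglyMeasurable hp.aemeasurable]
    exact hint2
  have e1 : ∫ ω, ε ω * g (W ω, ε ω) ∂μ
      = ∫ p : 𝒲 × ℝ, p.2 * g p ∂((μ.map W).prod (gaussianReal 0 v)) := by
    rw [← hmap, integral_map hp.aemeasurable hm1.aestronglyMeasurable]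
  have e2 : ∫ ω, g' (W ω, ε ω) ∂μ = ∫ p, g' p ∂((μ.map W).prod (gaussianReal 0 v)) := by
    rw [← hmap, integral_map hp.aemeasurable hg'.aestronglyMeasurable]
  rw [e1, e2, integral_prod _ i1, integral_prod _ i2, ← integral_const_mul]
  refine integral_congr_ae ?_
  filter_upwards [i1.prod_right_ae, i2.prod_right_ae] with w h1 h2
  exact stein_one v hv (fun e => g (w, e)) (fun e => g' (w, e)) (hderiv w) h1 h2
end

section
/- (Lemma 3: transition points are avoided for almost every response.) Fix the design matrix X ∈ ℝ^{N×p} and fix (λ₁, λ₂) ∈ (0,∞)². Call (λ₁, λ₂) a transition point for y ∈ ℝ^N if the map (μ₁, μ₂) ↦ sign vector of θ̂_{μ₁,μ₂}(y) is not constant on any neighborhood of (λ₁, λ₂) in (0,∞)². Then the set {y ∈ ℝ^N : (λ₁, λ₂) is a transition point for y} has Lebesgue measure zero. -/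
open MeasureTheory
open scoped BigOperators Topology

def enObj {N p : ℕ} (X : Matrix (Fin N) (Fin p) ℝ) (m1 m2 : ℝ) (y : Fin N → ℝ) (θ : Fin p → ℝ) : ℝ :=
  (∑ i, (y i - ∑ j, X i j * θ j) ^ 2) + m1 * (∑ j, |θ j|) + m2 * (∑ j, θ j ^ 2)

def enCor {N p : ℕ} (X : Matrix (Fin N) (Fin p) ℝ) (y : Fin N → ℝ) (θ : Fin p → ℝ) (j : Fin p) : ℝ :=
  2 * ∑ i, X i j * (y i - ∑ k, X i k * θ k)

lemma en_slope (b K δ : ℝ) (hδ : 0 < δ) (h : ∀ t, 0 < t → t ≤ δ → 0 ≤ b * t + K * t ^ 2) : 0 ≤ b := by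
  by_contra hb
  push Not at hb
  have hK : 0 < |K| + 1 := by positivity
  set t := min δ (-b / (2 * (|K| + 1))) with ht
  have ht0 : 0 < t := lt_min hδ (div_pos (by linarith) (by positivity))
  have h1 := h t ht0 (min_le_left _ _)
  have h2 : t * (2 * (|K| + 1)) ≤ -b := by
    rw [← le_div_iff₀ (by positivity)]
    exact min_le_right _ _
  have h3 : K ≤ |K| := le_abs_self K
  have h4 : 0 ≤ t * (b + K * t) := by nlinarith
  have h5 : 0 ≤ b + K * t := nonneg_of_mul_nonneg_right h4 ht0
  nlinarith

lemma en_oneD (c K m1 m2 x : ℝ)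
    (h : ∀ t, 0 ≤ -c * t + K * t ^ 2 + 2 * m2 * x * t + m1 * (|x + t| - |x|)) :
    (0 < x → c = m1 + 2 * m2 * x) ∧ (x < 0 → c = -m1 + 2 * m2 * x) ∧ (x = 0 → |c| ≤ m1) := by
  refine ⟨fun hx => ?_, fun hx => ?_, fun hx => ?_⟩
  · apply le_antisymm
    · have := en_slope (-c + 2 * m2 * x + m1) K x hx (fun t h0 h1 => by
        have := h t
        rw [abs_of_pos hx, abs_of_nonneg (by linarith)] at this
        linarith)
      linarith
    · have := en_slope (c - 2 * m2 * x - m1) K x hx (fun t h0 h1 => by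
        have := h (-t)
        rw [abs_of_pos hx, abs_of_nonneg (by linarith)] at this
        linarith)
      linarith
  · apply le_antisymm
    · have := en_slope (-c + 2 * m2 * x - m1) K (-x) (by linarith) (fun t h0 h1 => by
        have := h t
        rw [abs_of_neg hx, abs_of_nonpos (by linarith)] at this
        linarith)
      linarith
    · have := en_slope (c - 2 * m2 * x + m1) K (-x) (by linarith) (fun t h0 h1 => by
        have := h (-t)
        rw [abs_of_neg hx, abs_of_nonpos (by linarith)] at this
        linarith)
      linarith
  · subst hx
    rw [abs_le]
    constructor
    · have := en_slope (c + m1) K 1 one_pos (fun t h0 h1 => by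
        have := h (-t)
        rw [zero_add, abs_neg, abs_of_pos h0, abs_zero] at this
        linarith)
      linarith
    · have := en_slope (-c + m1) K 1 one_pos (fun t h0 h1 => by
        have := h t
        rw [zero_add, abs_of_pos h0, abs_zero] at this
        linarith)
      linarith

lemma en_pert {N p : ℕ} (X : Matrix (Fin N) (Fin p) ℝ) (m1 m2 : ℝ) (y : Fin N → ℝ) (θ : Fin p → ℝ)
    (j : Fin p) (t : ℝ) :
    enObj X m1 m2 y (Function.update θ j (θ j + t)) - enObj X m1 m2 y θ =
      -(enCor X y θ j) * t + ((∑ i, X i j ^ 2) + m2) * t ^ 2 + 2 * m2 * θ j * t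
        + m1 * (|θ j + t| - |θ j|) := by
  have key : ∀ g : Fin p → ℝ → ℝ, ∑ k, g k (Function.update θ j (θ j + t) k)
      = ∑ k, g k (θ k) + (g j (θ j + t) - g j (θ j)) := by
    intro g
    rw [← sub_eq_iff_eq_add', ← Finset.sum_sub_distrib, Finset.sum_eq_single j]
    · simp
    · intro b _ hb
      simp [Function.update_of_ne hb]
    · simp
  unfold enObj enCor
  rw [key (fun _ v => |v|), key (fun _ v => v ^ 2)]
  have h1 : ∀ i, (y i - ∑ k, X i k * Function.update θ j (θ j + t) k) ^ 2 =
      (y i - ∑ k, X i k * θ k) ^ 2 - 2 * t * (X i j * (y i - ∑ k, X i k * θ k)) + t ^ 2 * X i j ^ 2 := by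
    intro i
    rw [key (fun k v => X i k * v)]
    ring
  simp_rw [h1]
  rw [Finset.sum_add_distrib, Finset.sum_sub_distrib, ← Finset.mul_sum, ← Finset.mul_sum]
  ring

lemma en_kkt {N p : ℕ} (X : Matrix (Fin N) (Fin p) ℝ) (m1 m2 : ℝ) (y : Fin N → ℝ) (θ : Fin p → ℝ)
    (hm : ∀ θ', enObj X m1 m2 y θ ≤ enObj X m1 m2 y θ') (j : Fin p) :
    (0 < θ j → enCor X y θ j = m1 + 2 * m2 * θ j) ∧
    (θ j < 0 → enCor X y θ j = -m1 + 2 * m2 * θ j) ∧ (θ j = 0 → |enCor X y θ j| ≤ m1) := by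
  apply en_oneD _ ((∑ i, X i j ^ 2) + m2)
  intro t
  rw [← en_pert]
  linarith [hm (Function.update θ j (θ j + t))]

lemma en_strong {N p : ℕ} (X : Matrix (Fin N) (Fin p) ℝ) (m1 m2 : ℝ) (h1 : 0 ≤ m1)
    (y : Fin N → ℝ) (θ θ' : Fin p → ℝ)
    (hm : ∀ θ', enObj X m1 m2 y θ ≤ enObj X m1 m2 y θ') :
    m2 / 2 * ∑ j, (θ' j - θ j) ^ 2 ≤ enObj X m1 m2 y θ' - enObj X m1 m2 y θ := by
  have h := hm (fun j => (θ j + θ' j) / 2)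
  have a1 : ∑ i, (y i - ∑ j, X i j * ((θ j + θ' j) / 2)) ^ 2 ≤
      (∑ i, (y i - ∑ j, X i j * θ j) ^ 2) / 2 + (∑ i, (y i - ∑ j, X i j * θ' j) ^ 2) / 2 := by
    rw [Finset.sum_div, Finset.sum_div, ← Finset.sum_add_distrib]
    refine Finset.sum_le_sum fun i _ => ?_
    have : ∑ j, X i j * ((θ j + θ' j) / 2) = (∑ j, X i j * θ j + ∑ j, X i j * θ' j) / 2 := by
      rw [← Finset.sum_add_distrib, Finset.sum_div]
      exact Finset.sum_congr rfl fun j _ => by ring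
    rw [this]
    nlinarith [sq_nonneg ((∑ j, X i j * θ j) - ∑ j, X i j * θ' j)]
  have a2 : ∑ j, |(θ j + θ' j) / 2| ≤ (∑ j, |θ j|) / 2 + (∑ j, |θ' j|) / 2 := by
    rw [Finset.sum_div, Finset.sum_div, ← Finset.sum_add_distrib]
    refine Finset.sum_le_sum fun i _ => ?_
    rw [abs_div, abs_two]
    linarith [abs_add_le (θ i) (θ' i)]
  have a3 : ∑ j, ((θ j + θ' j) / 2) ^ 2 = (∑ j, θ j ^ 2) / 2 + (∑ j, θ' j ^ 2) / 2
      - (∑ j, (θ' j - θ j) ^ 2) / 4 := by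
    rw [Finset.sum_div, Finset.sum_div, Finset.sum_div, ← Finset.sum_add_distrib,
      ← Finset.sum_sub_distrib]
    exact Finset.sum_congr rfl fun j _ => by ring
  have a4 := mul_le_mul_of_nonneg_left a2 h1
  unfold enObj at h ⊢
  rw [a3] at h
  linarith

lemma en_bound {N p : ℕ} (X : Matrix (Fin N) (Fin p) ℝ) (m1 m2 : ℝ) (h1 : 0 ≤ m1) (h2 : 0 ≤ m2)
    (y : Fin N → ℝ) (θ : Fin p → ℝ)
    (hm : ∀ θ', enObj X m1 m2 y θ ≤ enObj X m1 m2 y θ') :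
    m1 * ∑ j, |θ j| ≤ ∑ i, y i ^ 2 ∧ m2 * ∑ j, θ j ^ 2 ≤ ∑ i, y i ^ 2 := by
  have h := hm 0
  simp only [enObj, Pi.zero_apply, mul_zero, Finset.sum_const_zero, sub_zero, abs_zero, add_zero,
    ne_eq, OfNat.ofNat_ne_zero, not_false_eq_true, zero_pow] at h
  have b1 : 0 ≤ ∑ i, (y i - ∑ j, X i j * θ j) ^ 2 := Finset.sum_nonneg fun _ _ => sq_nonneg _
  have b2 : 0 ≤ m1 * ∑ j, |θ j| := mul_nonneg h1 (Finset.sum_nonneg fun _ _ => abs_nonneg _)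
  have b3 : 0 ≤ m2 * ∑ j, θ j ^ 2 := mul_nonneg h2 (Finset.sum_nonneg fun _ _ => sq_nonneg _)
  constructor <;> linarith

lemma en_tendsto {N p : ℕ} (X : Matrix (Fin N) (Fin p) ℝ) (l1 l2 : ℝ) (hl1 : 0 < l1) (hl2 : 0 < l2)
    (y : Fin N → ℝ) (T : ℝ → ℝ → (Fin p → ℝ))
    (hm : ∀ m1 m2 : ℝ, 0 < m1 → 0 < m2 → ∀ θ', enObj X m1 m2 y (T m1 m2) ≤ enObj X m1 m2 y θ') :
    Filter.Tendsto (fun m : ℝ × ℝ => T m.1 m.2) (𝓝 (l1, l2)) (𝓝 (T l1 l2)) := by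
  set Q := ∑ i, y i ^ 2 with hQ
  have hQ0 : 0 ≤ Q := Finset.sum_nonneg fun _ _ => sq_nonneg _
  have e1 : ∀ᶠ m : ℝ × ℝ in 𝓝 (l1, l2), l1 / 2 < m.1 :=
    continuous_fst.continuousAt.eventually (lt_mem_nhds (by simp; linarith))
  have e2 : ∀ᶠ m : ℝ × ℝ in 𝓝 (l1, l2), l2 / 2 < m.2 :=
    continuous_snd.continuousAt.eventually (lt_mem_nhds (by simp; linarith))
  have hD : ∀ᶠ m : ℝ × ℝ in 𝓝 (l1, l2), ∑ j, (T m.1 m.2 j - T l1 l2 j) ^ 2 ≤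
      (|m.1 - l1| * (2 * Q / l1) + |m.2 - l2| * (2 * Q / l2)) * (2 / l2) := by
    filter_upwards [e1, e2] with m h1 h2
    obtain ⟨m1, m2⟩ := m
    dsimp only at h1 h2 ⊢
    have p1 : 0 < m1 := by linarith
    have p2 : 0 < m2 := by linarith
    have s1 := en_strong X m1 m2 p1.le y _ (T l1 l2) (hm m1 m2 p1 p2)
    have s2 := en_strong X l1 l2 hl1.le y _ (T m1 m2) (hm l1 l2 hl1 hl2)
    obtain ⟨c1, c2⟩ := en_bound X m1 m2 p1.le p2.le y _ (hm m1 m2 p1 p2)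
    obtain ⟨d1, d2⟩ := en_bound X l1 l2 hl1.le hl2.le y _ (hm l1 l2 hl1 hl2)
    unfold enObj at s1 s2
    rw [← hQ] at c1 c2 d1 d2
    have n1 : 0 ≤ ∑ j, |T m1 m2 j| := Finset.sum_nonneg fun _ _ => abs_nonneg _
    have n2 : 0 ≤ ∑ j, T m1 m2 j ^ 2 := Finset.sum_nonneg fun _ _ => sq_nonneg _
    have n3 : 0 ≤ ∑ j, |T l1 l2 j| := Finset.sum_nonneg fun _ _ => abs_nonneg _
    have n4 : 0 ≤ ∑ j, T l1 l2 j ^ 2 := Finset.sum_nonneg fun _ _ => sq_nonneg _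
    have n5 : 0 ≤ ∑ j, (T l1 l2 j - T m1 m2 j) ^ 2 := Finset.sum_nonneg fun _ _ => sq_nonneg _
    set A := ∑ j, |T m1 m2 j|
    set B := ∑ j, T m1 m2 j ^ 2
    set A' := ∑ j, |T l1 l2 j|
    set B' := ∑ j, T l1 l2 j ^ 2
    have q1 : A ≤ 2 * Q / l1 := by rw [le_div_iff₀ hl1]; nlinarith
    have q2 : A' ≤ 2 * Q / l1 := by rw [le_div_iff₀ hl1]; nlinarith
    have q3 : B ≤ 2 * Q / l2 := by rw [le_div_iff₀ hl2]; nlinarith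
    have q4 : B' ≤ 2 * Q / l2 := by rw [le_div_iff₀ hl2]; nlinarith
    have r1 : (m1 - l1) * (A' - A) ≤ |m1 - l1| * (2 * Q / l1) := by
      refine (le_abs_self _).trans ?_
      rw [abs_mul]
      exact mul_le_mul_of_nonneg_left (abs_le.2 ⟨by linarith, by linarith⟩) (abs_nonneg _)
    have r2 : (m2 - l2) * (B' - B) ≤ |m2 - l2| * (2 * Q / l2) := by
      refine (le_abs_self _).trans ?_
      rw [abs_mul]
      exact mul_le_mul_of_nonneg_left (abs_le.2 ⟨by linarith, by linarith⟩) (abs_nonneg _)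
    have n6 := mul_nonneg (half_pos p2).le n5
    rw [mul_div_assoc', le_div_iff₀ hl2]
    linarith
  rw [tendsto_pi_nhds]
  intro j
  have hz : Filter.Tendsto (fun m : ℝ × ℝ =>
      (|m.1 - l1| * (2 * Q / l1) + |m.2 - l2| * (2 * Q / l2)) * (2 / l2)) (𝓝 (l1, l2)) (𝓝 0) := by
    have : Continuous (fun m : ℝ × ℝ =>
      (|m.1 - l1| * (2 * Q / l1) + |m.2 - l2| * (2 * Q / l2)) * (2 / l2)) := by fun_prop
    simpa using this.tendsto (l1, l2)
  have hsq : Filter.Tendsto (fun m : ℝ × ℝ => (T m.1 m.2 j - T l1 l2 j) ^ 2) (𝓝 (l1, l2)) (𝓝 0) := by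
    refine squeeze_zero' (Filter.Eventually.of_forall fun _ => sq_nonneg _) ?_ hz
    filter_upwards [hD] with m h
    exact (Finset.single_le_sum (f := fun j => (T m.1 m.2 j - T l1 l2 j) ^ 2)
      (fun _ _ => sq_nonneg _) (Finset.mem_univ j)).trans h
  have hab := hsq.sqrt
  simp only [Real.sqrt_sq_eq_abs, Real.sqrt_zero] at hab
  have := (tendsto_zero_iff_abs_tendsto_zero _).2 hab
  exact tendsto_sub_nhds_zero_iff.1 this

lemma en_hyper {N : ℕ} (v : Fin N → ℝ) (c : ℝ) (hc : c ≠ 0) :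
    volume {r : Fin N → ℝ | ∑ i, v i * r i = c} = 0 := by
  let S : AffineSubspace ℝ (Fin N → ℝ) :=
    { carrier := {r : Fin N → ℝ | ∑ i, v i * r i = c}
      smul_vsub_vadd_mem' := by
        intro t a b d ha hb hd
        simp only [Set.mem_ofPred_eq] at *
        have : ∑ i, v i * (t • (a -ᵥ b) +ᵥ d) i
            = t * (∑ i, v i * a i - ∑ i, v i * b i) + ∑ i, v i * d i := by
          rw [← Finset.sum_sub_distrib, Finset.mul_sum, ← Finset.sum_add_distrib]
          refine Finset.sum_congr rfl fun i _ => ?_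
          simp
          ring
        rw [this, ha, hb, hd]
        ring }
  have hS : S ≠ ⊤ := by
    intro h
    have : (0 : Fin N → ℝ) ∈ S := h ▸ AffineSubspace.mem_top ℝ _ _
    have h' : ∑ i, v i * (0 : Fin N → ℝ) i = c := this
    simp at h'
    exact hc h'.symm
  exact Measure.addHaar_affineSubspace volume S hS

lemma en_null {N p : ℕ} (X : Matrix (Fin N) (Fin p) ℝ) (l1 l2 : ℝ) (hl1 : 0 < l1) (hl2 : 0 < l2)
    (T : (Fin N → ℝ) → (Fin p → ℝ))
    (hm : ∀ y θ', enObj X l1 l2 y (T y) ≤ enObj X l1 l2 y θ') :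
    volume {y : Fin N → ℝ | ∃ j, |enCor X y (T y) j| = l1} = 0 := by
  let F : (Fin p → SignType) → (Fin N → ℝ) → (Fin N → ℝ) := fun s r i =>
    r i + ∑ k, X i k * (((s k : ℝ)) ^ 2 * ((∑ i, X i k * r i) - l1 * (s k : ℝ) / 2) / l2)
  have hF : ∀ s, Differentiable ℝ (F s) := by
    intro s
    simp only [F]
    fun_prop
  have hsub : {y : Fin N → ℝ | ∃ j, |enCor X y (T y) j| = l1} ⊆
      ⋃ (s : Fin p → SignType), ⋃ (j : Fin p),
        (F s '' {r | ∑ i, X i j * r i = l1 / 2} ∪ F s '' {r | ∑ i, X i j * r i = -l1 / 2}) := by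
    rintro y ⟨j, hj⟩
    rw [Set.mem_iUnion]
    refine ⟨fun k => SignType.sign (T y k), ?_⟩
    rw [Set.mem_iUnion]
    refine ⟨j, ?_⟩
    have hy : F (fun k => SignType.sign (T y k)) (fun i => y i - ∑ k, X i k * T y k) = y := by
      funext i
      have : ∀ k, (((SignType.sign (T y k) : SignType) : ℝ)) ^ 2 *
          ((∑ i, X i k * (y i - ∑ k, X i k * T y k))
            - l1 * ((SignType.sign (T y k) : SignType) : ℝ) / 2) / l2 = T y k := by
        intro k
        obtain ⟨k1, k2, -⟩ := en_kkt X l1 l2 y (T y) (hm y) k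
        unfold enCor at k1 k2
        rw [div_eq_iff hl2.ne']
        rcases lt_trichotomy (T y k) 0 with h | h | h
        · have := k2 h
          simp only [sign_neg h, SignType.coe_neg_one]
          linarith
        · simp [h]
        · have := k1 h
          simp only [sign_pos h, SignType.coe_one]
          linarith
      simp only [F, this]
      ring
    unfold enCor at hj
    rcases (abs_eq hl1.le).1 hj with h | h
    · left
      exact ⟨_, by simp only [Set.mem_ofPred_eq]; linarith, hy⟩
    · right
      exact ⟨_, by simp only [Set.mem_ofPred_eq]; linarith, hy⟩
  refine measure_mono_null hsub ?_
  refine measure_iUnion_null fun s => measure_iUnion_null fun j => measure_union_null ?_ ?_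
  · exact addHaar_image_eq_zero_of_differentiableOn_of_addHaar_eq_zero volume
      (hF s).differentiableOn (en_hyper (fun i => X i j) _ (by positivity))
  · exact addHaar_image_eq_zero_of_differentiableOn_of_addHaar_eq_zero volume
      (hF s).differentiableOn (en_hyper (fun i => X i j) _ (by
        have : -l1 / 2 < 0 := by linarith
        exact this.ne))

/-- (Lemma 3: transition points are avoided for almost every response.)
Fix the design matrix `X` and `(λ₁, λ₂) ∈ (0,∞)²`.  The set of responses `y` for which
`(λ₁, λ₂)` is a transition point of the elastic net — i.e. for which the map
`(μ₁, μ₂) ↦ sign vector of θ̂_{μ₁,μ₂}(y)` is not constant on any neighborhood of `(λ₁, λ₂)`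
in `(0,∞)²` — has Lebesgue measure zero. -/
theorem stmt10
    (N p : ℕ) (X : Matrix (Fin N) (Fin p) ℝ)
    (l1 l2 : ℝ) (hl1 : 0 < l1) (hl2 : 0 < l2)
    (θhat : ℝ → ℝ → (Fin N → ℝ) → (Fin p → ℝ))
    (hmin : ∀ μ1 μ2 : ℝ, 0 < μ1 → 0 < μ2 → ∀ y : Fin N → ℝ, ∀ θ : Fin p → ℝ,
      (∑ i, (y i - ∑ j, X i j * θhat μ1 μ2 y j) ^ 2)
          + μ1 * (∑ j, |θhat μ1 μ2 y j|) + μ2 * (∑ j, θhat μ1 μ2 y j ^ 2)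
        ≤ (∑ i, (y i - ∑ j, X i j * θ j) ^ 2)
          + μ1 * (∑ j, |θ j|) + μ2 * (∑ j, θ j ^ 2)) :
    volume {y : Fin N → ℝ |
      ¬ ∀ᶠ m in 𝓝[Set.Ioi (0:ℝ) ×ˢ Set.Ioi (0:ℝ)] (l1, l2),
          (fun j => Real.sign (θhat m.1 m.2 y j))
            = fun j => Real.sign (θhat l1 l2 y j)} = 0 := by
  have hm : ∀ y : Fin N → ℝ, ∀ m1 m2 : ℝ, 0 < m1 → 0 < m2 → ∀ θ',
      enObj X m1 m2 y (θhat m1 m2 y) ≤ enObj X m1 m2 y θ' :=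
    fun y m1 m2 h1 h2 θ' => hmin m1 m2 h1 h2 y θ'
  refine measure_mono_null ?_ (en_null X l1 l2 hl1 hl2 (θhat l1 l2) fun y => hm y l1 l2 hl1 hl2)
  intro y hy
  by_contra hgood
  apply hy
  simp only [Set.mem_ofPred_eq, not_exists] at hgood
  have hT := en_tendsto X l1 l2 hl1 hl2 y (fun a b => θhat a b y) (hm y)
  have hall : ∀ j, ∀ᶠ m : ℝ × ℝ in 𝓝[Set.Ioi (0:ℝ) ×ˢ Set.Ioi (0:ℝ)] (l1, l2),
      Real.sign (θhat m.1 m.2 y j) = Real.sign (θhat l1 l2 y j) := by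
    intro j
    have hTj := (tendsto_pi_nhds.1 hT) j
    rcases lt_trichotomy (θhat l1 l2 y j) 0 with h | h | h
    · filter_upwards [nhdsWithin_le_nhds (hTj.eventually (gt_mem_nhds h))] with m hmm
      rw [Real.sign_of_neg h, Real.sign_of_neg hmm]
    · have hlt : |enCor X y (θhat l1 l2 y) j| < l1 :=
        lt_of_le_of_ne ((en_kkt X l1 l2 y _ (hm y l1 l2 hl1 hl2) j).2.2 h) (hgood j)
      have hcont : Continuous (fun θ : Fin p → ℝ => |enCor X y θ j|) := by
        unfold enCor
        fun_prop
      have hC := (hcont.tendsto _).comp hT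
      have hev := hC.eventually_lt (continuous_fst.tendsto (l1, l2)) hlt
      filter_upwards [nhdsWithin_le_nhds hev, self_mem_nhdsWithin] with m hmm hpos
      obtain ⟨p1, p2⟩ := hpos
      simp only [Set.mem_Ioi] at p1 p2
      simp only [Function.comp] at hmm
      rw [abs_lt] at hmm
      obtain ⟨k1, k2, -⟩ := en_kkt X m.1 m.2 y _ (hm y m.1 m.2 p1 p2) j
      have hz : θhat m.1 m.2 y j = 0 := by
        rcases lt_trichotomy (θhat m.1 m.2 y j) 0 with g | g | g
        · have := k2 g
          nlinarith [mul_pos_of_neg_of_neg g (neg_lt_zero.2 p2)]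
        · exact g
        · have := k1 g
          nlinarith [mul_pos g p2]
      rw [hz, h]
    · filter_upwards [nhdsWithin_le_nhds (hTj.eventually (lt_mem_nhds h))] with m hmm
      rw [Real.sign_of_pos h, Real.sign_of_pos hmm]
  filter_upwards [Filter.eventually_all.2 hall] with m h
  funext j
  exact h j
end

section
/- (Lemma 4: continuity of the elastic net solution map.) Fix the design matrix X ∈ ℝ^{N×p}, λ₁ ≥ 0 and λ₂ > 0. Then the map y ↦ θ̂_{λ₁,λ₂}(y) from ℝ^N to ℝ^p is continuous. -/
open scoped BigOperators

/-- (Lemma 4: continuity of the elastic net solution map.)  For fixed design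
matrix `X`, `λ₁ ≥ 0` and `λ₂ > 0`, the map `y ↦ θ̂_{λ₁,λ₂}(y)` is continuous. -/
theorem stmt11
    (N p : ℕ) (X : Matrix (Fin N) (Fin p) ℝ)
    (l1 l2 : ℝ) (hl1 : 0 ≤ l1) (hl2 : 0 < l2)
    (θhat : (Fin N → ℝ) → (Fin p → ℝ))
    (hmin : ∀ y : Fin N → ℝ, ∀ θ : Fin p → ℝ,
      (∑ i, (y i - ∑ j, X i j * θhat y j) ^ 2)
          + l1 * (∑ j, |θhat y j|) + l2 * (∑ j, θhat y j ^ 2)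
        ≤ (∑ i, (y i - ∑ j, X i j * θ j) ^ 2)
          + l1 * (∑ j, |θ j|) + l2 * (∑ j, θ j ^ 2)) :
    Continuous θhat := by
  have key : ∀ (y : Fin N → ℝ) (b : Fin p → ℝ),
      (∑ i, (y i - ∑ j, X i j * θhat y j) ^ 2)
          + l1 * (∑ j, |θhat y j|) + l2 * (∑ j, θhat y j ^ 2)
          + ((∑ i, (∑ j, X i j * θhat y j - ∑ j, X i j * b j) ^ 2)
            + l2 * ∑ j, (θhat y j - b j) ^ 2) / 2
        ≤ (∑ i, (y i - ∑ j, X i j * b j) ^ 2)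
          + l1 * (∑ j, |b j|) + l2 * (∑ j, b j ^ 2) := by
    intro y b
    have h := hmin y (fun j => (θhat y j + b j) / 2)
    generalize θhat y = a at h ⊢
    have e1 : ∀ i, ∑ j, X i j * ((a j + b j) / 2)
        = (∑ j, X i j * a j + ∑ j, X i j * b j) / 2 := by
      intro i
      rw [← Finset.sum_add_distrib, Finset.sum_div]
      exact Finset.sum_congr rfl fun j _ => by ring
    have e2 : ∑ i, (y i - ∑ j, X i j * ((a j + b j) / 2)) ^ 2
        = (∑ i, (y i - ∑ j, X i j * a j) ^ 2) / 2 + (∑ i, (y i - ∑ j, X i j * b j) ^ 2) / 2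
          - (∑ i, (∑ j, X i j * a j - ∑ j, X i j * b j) ^ 2) / 4 := by
      simp only [Finset.sum_div]
      rw [← Finset.sum_add_distrib, ← Finset.sum_sub_distrib]
      refine Finset.sum_congr rfl fun i _ => ?_
      rw [e1]
      ring
    have e3 : ∑ j, ((a j + b j) / 2) ^ 2
        = (∑ j, a j ^ 2) / 2 + (∑ j, b j ^ 2) / 2 - (∑ j, (a j - b j) ^ 2) / 4 := by
      simp only [Finset.sum_div]
      rw [← Finset.sum_add_distrib, ← Finset.sum_sub_distrib]
      exact Finset.sum_congr rfl fun i _ => by ring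
    have e4 : ∑ j, |(a j + b j) / 2| ≤ (∑ j, |a j|) / 2 + (∑ j, |b j|) / 2 := by
      simp only [Finset.sum_div]
      rw [← Finset.sum_add_distrib]
      refine Finset.sum_le_sum fun j _ => ?_
      rw [abs_div, abs_two]
      linarith [abs_add_le (a j) (b j)]
    have e5 := mul_le_mul_of_nonneg_left e4 hl1
    rw [e2, e3] at h
    linarith
  have main : ∀ y z : Fin N → ℝ,
      l2 * ∑ j, (θhat y j - θhat z j) ^ 2 ≤ ∑ i, (y i - z i) ^ 2 := by
    intro y z
    have h1 := key y (θhat z)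
    have h2 := key z (θhat y)
    generalize θhat y = a at h1 h2 ⊢
    generalize θhat z = b at h1 h2 ⊢
    have s1 : ∑ j, (b j - a j) ^ 2 = ∑ j, (a j - b j) ^ 2 :=
      Finset.sum_congr rfl fun j _ => by ring
    have s2 : ∑ i, (∑ j, X i j * b j - ∑ j, X i j * a j) ^ 2
        = ∑ i, (∑ j, X i j * a j - ∑ j, X i j * b j) ^ 2 :=
      Finset.sum_congr rfl fun j _ => by ring
    rw [s1, s2] at h2
    have h3 : ∑ i, (y i - ∑ j, X i j * b j) ^ 2 + ∑ i, (z i - ∑ j, X i j * a j) ^ 2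
        ≤ ∑ i, (y i - ∑ j, X i j * a j) ^ 2 + ∑ i, (z i - ∑ j, X i j * b j) ^ 2
          + ∑ i, (y i - z i) ^ 2 + ∑ i, (∑ j, X i j * a j - ∑ j, X i j * b j) ^ 2 := by
      simp only [← Finset.sum_add_distrib]
      refine Finset.sum_le_sum fun i _ => ?_
      nlinarith [sq_nonneg (y i - z i - (∑ j, X i j * a j - ∑ j, X i j * b j))]
    linarith
  rw [continuous_pi_iff]
  intro j
  rw [continuous_iff_continuousAt]
  intro z
  have hc : Continuous fun y : Fin N → ℝ => Real.sqrt ((∑ i, (y i - z i) ^ 2) / l2) := by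
    fun_prop
  have ht := hc.tendsto z
  simp only [sub_self, ne_eq, OfNat.ofNat_ne_zero, not_false_eq_true, zero_pow,
    Finset.sum_const_zero, zero_div, Real.sqrt_zero] at ht
  refine tendsto_iff_dist_tendsto_zero.2 (squeeze_zero (fun _ => dist_nonneg) (fun y => ?_) ht)
  rw [Real.dist_eq]
  apply Real.abs_le_sqrt
  rw [le_div_iff₀ hl2, mul_comm]
  refine le_trans (mul_le_mul_of_nonneg_left ?_ hl2.le) (main y z)
  exact Finset.single_le_sum (f := fun j => (θhat y j - θhat z j) ^ 2)
    (fun _ _ => sq_nonneg _) (Finset.mem_univ j)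
end

section
/- (Lemma 5: local constancy of the active set and sign vector.) Fix the design matrix X ∈ ℝ^{N×p} and (λ₁, λ₂) ∈ (0,∞)². There exists a Lebesgue-null set 𝒩 ⊆ ℝ^N such that for every y* ∈ ℝ^N \ 𝒩 there is ε > 0 with the property that the sign vector of θ̂_{λ₁,λ₂}(y) equals the sign vector of θ̂_{λ₁,λ₂}(y*) for every y ∈ ℝ^N with ‖y − y*‖ < ε; in particular the active set {j : θ̂_{λ₁,λ₂}(y)_j ≠ 0} is locally constant in y on ℝ^N \ 𝒩. -/
open MeasureTheory
open scoped BigOperators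

/-- The scaled partial (negative) gradient of the smooth part of the elastic net objective. -/
def enetG {N p : ℕ} (X : Matrix (Fin N) (Fin p) ℝ) (l2 : ℝ)
    (y : Fin N → ℝ) (θ : Fin p → ℝ) (j : Fin p) : ℝ :=
  2 * (∑ i, X i j * (y i - ∑ k, X i k * θ k)) - 2 * l2 * θ j

/-- KKT conditions. -/
def enetK {N p : ℕ} (X : Matrix (Fin N) (Fin p) ℝ) (l1 l2 : ℝ)
    (y : Fin N → ℝ) (θ : Fin p → ℝ) : Prop :=
  ∀ j, |enetG X l2 y θ j| ≤ l1 ∧ enetG X l2 y θ j * θ j = l1 * |θ j|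

lemma enet_scalar (g l1 u C : ℝ) (hl1 : 0 < l1) 
    (h : ∀ t : ℝ, g * t ≤ l1 * (|u + t| - |u|) + C * t ^ 2) :
    |g| ≤ l1 ∧ g * u = l1 * |u| := by
  have key : ∀ t : ℝ, g * t ≤ l1 * (|u + t| - |u|) := by
    intro t
    have hev : ∀ e : ℝ, 0 < e → e ≤ 1 → g * t ≤ l1 * (|u + t| - |u|) + C * t ^ 2 * e := by
      intro e he he1
      have h1 := h (e * t)
      have h2 : |u + e * t| ≤ (1 - e) * |u| + e * |u + t| := by
        have : u + e * t = (1 - e) * u + e * (u + t) := by ring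
        rw [this]
        refine (abs_add_le _ _).trans ?_
        rw [abs_mul, abs_mul, abs_of_pos he, abs_of_nonneg (sub_nonneg.2 he1)]
      have h3 : e * (g * t) ≤ e * (l1 * (|u + t| - |u|) + C * t ^ 2 * e) := by
        have := mul_le_mul_of_nonneg_left h2 hl1.le
        nlinarith
      exact le_of_mul_le_mul_left h3 he
    by_contra hc
    push Not at hc
    set d := g * t - l1 * (|u + t| - |u|) with hd
    have hd0 : 0 < d := by linarith
    have hq : 0 < |C * t ^ 2| + d + 1 := by positivity
    have h1 := hev (d / (|C * t ^ 2| + d + 1)) (by positivity)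
      (by rw [div_le_one hq]; linarith [abs_nonneg (C * t ^ 2)])
    have h2 : C * t ^ 2 * (d / (|C * t ^ 2| + d + 1)) < d := by
      rw [← mul_div_assoc, div_lt_iff₀ hq]
      nlinarith [le_abs_self (C * t ^ 2)]
    linarith
  have hp := key 1
  have hm := key (-1)
  have hu := key u
  have hn := key (-u)
  have a1 : |u + 1| - |u| ≤ 1 := by have := abs_add_le u 1; simp at this; linarith
  have a2 : |u + -1| - |u| ≤ 1 := by have := abs_add_le u (-1); simp at this; simp; linarith
  have a3 : |u + u| = 2 * |u| := by rw [← two_mul, abs_mul]; simp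
  rw [a3] at hu
  simp at hn
  refine ⟨abs_le.2 ⟨by nlinarith, by nlinarith⟩, by linarith⟩

lemma enet_necessary {N p : ℕ} (X : Matrix (Fin N) (Fin p) ℝ) (l1 l2 : ℝ) (hl1 : 0 < l1)
    (y : Fin N → ℝ) (θ₀ : Fin p → ℝ)
    (hmin : ∀ θ : Fin p → ℝ,
      (∑ i, (y i - ∑ j, X i j * θ₀ j) ^ 2) + l1 * (∑ j, |θ₀ j|) + l2 * (∑ j, θ₀ j ^ 2)
        ≤ (∑ i, (y i - ∑ j, X i j * θ j) ^ 2) + l1 * (∑ j, |θ j|) + l2 * (∑ j, θ j ^ 2)) :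
    enetK X l1 l2 y θ₀ := by
  intro j
  apply enet_scalar _ _ _ ((∑ i, X i j ^ 2) + l2) hl1
  intro t
  have h := hmin (θ₀ + Pi.single j t)
  have e1 : ∀ i, ∑ k, X i k * (θ₀ + Pi.single j t : Fin p → ℝ) k = (∑ k, X i k * θ₀ k) + X i j * t := by
    intro i
    simp [mul_add, Finset.sum_add_distrib, Pi.single_apply]
  have e2 : ∑ i, (y i - ∑ k, X i k * (θ₀ + Pi.single j t : Fin p → ℝ) k) ^ 2
      = (∑ i, (y i - ∑ k, X i k * θ₀ k) ^ 2)
        - 2 * t * (∑ i, X i j * (y i - ∑ k, X i k * θ₀ k)) + (∑ i, X i j ^ 2) * t ^ 2 := by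
    simp_rw [e1]
    rw [Finset.mul_sum, Finset.sum_mul, ← Finset.sum_sub_distrib, ← Finset.sum_add_distrib]
    exact Finset.sum_congr rfl fun i _ => by ring
  have e3 : ∀ f : ℝ → ℝ, ∑ k, f ((θ₀ + Pi.single j t : Fin p → ℝ) k)
      = (∑ k, f (θ₀ k)) + (f (θ₀ j + t) - f (θ₀ j)) := by
    intro f
    rw [← sub_eq_iff_eq_add', ← Finset.sum_sub_distrib, Finset.sum_eq_single j]
    · simp
    · intro k _ hk
      simp [hk]
    · simp
  have e4 := e3 (fun u => |u|)
  have e5 := e3 (fun u => u ^ 2)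
  rw [e2, e4, e5] at h
  unfold enetG
  nlinarith

lemma enet_unique {N p : ℕ} (X : Matrix (Fin N) (Fin p) ℝ) (l1 l2 : ℝ) (hl2 : 0 < l2)
    (y : Fin N → ℝ) (θ θ' : Fin p → ℝ)
    (h : enetK X l1 l2 y θ) (h' : enetK X l1 l2 y θ') : θ = θ' := by
  have hmono : 0 ≤ ∑ j, (enetG X l2 y θ j - enetG X l2 y θ' j) * (θ j - θ' j) := by
    refine Finset.sum_nonneg fun j _ => ?_
    obtain ⟨a, b⟩ := h j
    obtain ⟨a', b'⟩ := h' j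
    have c : enetG X l2 y θ j * θ' j ≤ l1 * |θ' j| :=
      (le_abs_self _).trans (by rw [abs_mul]; gcongr)
    have c' : enetG X l2 y θ' j * θ j ≤ l1 * |θ j| :=
      (le_abs_self _).trans (by rw [abs_mul]; gcongr)
    nlinarith
  have hg : ∀ j, enetG X l2 y θ j - enetG X l2 y θ' j
      = -2 * (∑ i, X i j * ∑ k, X i k * (θ k - θ' k)) - 2 * l2 * (θ j - θ' j) := by
    intro j
    have : ∑ i, X i j * ∑ k, X i k * (θ k - θ' k)
        = (∑ i, X i j * (y i - ∑ k, X i k * θ' k)) - ∑ i, X i j * (y i - ∑ k, X i k * θ k) := by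
      rw [← Finset.sum_sub_distrib]
      refine Finset.sum_congr rfl fun i _ => ?_
      simp only [mul_sub (X i _) (θ _), Finset.sum_sub_distrib]
      ring
    rw [this]; unfold enetG; ring
  have hs : ∑ j, (enetG X l2 y θ j - enetG X l2 y θ' j) * (θ j - θ' j)
      = -2 * (∑ i, (∑ k, X i k * (θ k - θ' k)) ^ 2) - 2 * l2 * ∑ j, (θ j - θ' j) ^ 2 := by
    have hx : ∑ i, (∑ k, X i k * (θ k - θ' k)) ^ 2
        = ∑ j, (∑ i, X i j * ∑ k, X i k * (θ k - θ' k)) * (θ j - θ' j) := by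
      simp_rw [Finset.sum_mul]
      rw [Finset.sum_comm]
      refine Finset.sum_congr rfl fun i _ => ?_
      rw [sq]
      conv_lhs => rw [Finset.sum_mul]
      exact Finset.sum_congr rfl fun j _ => by ring
    rw [hx, Finset.mul_sum, Finset.mul_sum, ← Finset.sum_sub_distrib]
    exact Finset.sum_congr rfl fun j _ => by rw [hg]; ring
  rw [hs] at hmono
  have h1 : 0 ≤ ∑ i, (∑ k, X i k * (θ k - θ' k)) ^ 2 := Finset.sum_nonneg fun i _ => sq_nonneg _
  have h2 : ∑ j, (θ j - θ' j) ^ 2 ≤ 0 := by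
    by_contra hc
    push Not at hc
    nlinarith [mul_pos hl2 hc]
  have h3 : ∑ j, (θ j - θ' j) ^ 2 = 0 :=
    le_antisymm h2 (Finset.sum_nonneg fun i _ => sq_nonneg _)
  rw [Finset.sum_eq_zero_iff_of_nonneg fun i _ => sq_nonneg _] at h3
  funext j
  have := h3 j (Finset.mem_univ j)
  exact sub_eq_zero.1 (pow_eq_zero_iff (two_ne_zero) |>.1 this)

lemma enet_sign_convex (s : SignType) (u v a b : ℝ) (ha : 0 ≤ a) (hb : 0 ≤ b) (hab : a + b = 1)
    (hu : SignType.sign u = s) (hv : SignType.sign v = s) : SignType.sign (a * u + b * v) = s := by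
  rcases s with _ | _ | _
  · have hu' : u = 0 := sign_eq_zero_iff.1 hu
    have hv' : v = 0 := sign_eq_zero_iff.1 hv
    simp [hu', hv']
  · have hu' : u < 0 := sign_eq_neg_one_iff.1 hu
    have hv' : v < 0 := sign_eq_neg_one_iff.1 hv
    exact sign_eq_neg_one_iff.2 ((convex_Iio (0:ℝ)) hu' hv' ha hb hab)
  · have hu' : 0 < u := sign_eq_one_iff.1 hu
    have hv' : 0 < v := sign_eq_one_iff.1 hv
    exact sign_eq_one_iff.2 ((convex_Ioi (0:ℝ)) hu' hv' ha hb hab)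

lemma enet_K_convex {N p : ℕ} (X : Matrix (Fin N) (Fin p) ℝ) (l1 l2 : ℝ)
    (y y' : Fin N → ℝ) (θ θ' : Fin p → ℝ) (a b : ℝ) (ha : 0 ≤ a) (hb : 0 ≤ b) (hab : a + b = 1)
    (hs : ∀ j, SignType.sign (θ j) = SignType.sign (θ' j))
    (h : enetK X l1 l2 y θ) (h' : enetK X l1 l2 y' θ') :
    enetK X l1 l2 (a • y + b • y') (a • θ + b • θ') := by
  intro j
  have hg : enetG X l2 (a • y + b • y') (a • θ + b • θ') j
      = a * enetG X l2 y θ j + b * enetG X l2 y' θ' j := by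
    have : ∑ i, X i j * ((a • y + b • y') i - ∑ k, X i k * (a • θ + b • θ') k)
        = a * (∑ i, X i j * (y i - ∑ k, X i k * θ k))
          + b * (∑ i, X i j * (y' i - ∑ k, X i k * θ' k)) := by
      rw [Finset.mul_sum, Finset.mul_sum, ← Finset.sum_add_distrib]
      refine Finset.sum_congr rfl fun i _ => ?_
      have : ∑ k, X i k * (a • θ + b • θ') k
          = a * (∑ k, X i k * θ k) + b * ∑ k, X i k * θ' k := by
        rw [Finset.mul_sum, Finset.mul_sum, ← Finset.sum_add_distrib]
        exact Finset.sum_congr rfl fun k _ => by simp; ring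
      rw [this]; simp; ring
    unfold enetG
    rw [this]; simp; ring
  obtain ⟨c, d⟩ := h j
  obtain ⟨c', d'⟩ := h' j
  rw [hg]
  refine ⟨?_, ?_⟩
  · rw [abs_le] at c c' ⊢
    constructor <;> nlinarith
  · have hsj := hs j
    simp only [Pi.add_apply, Pi.smul_apply, smul_eq_mul]
    rcases lt_trichotomy (θ j) 0 with h0 | h0 | h0
    · have h0' : θ' j < 0 := by rw [sign_neg h0] at hsj; exact sign_eq_neg_one_iff.1 hsj.symm
      rw [abs_of_neg h0] at d
      rw [abs_of_neg h0'] at d'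
      have e : enetG X l2 y θ j = -l1 := mul_right_cancel₀ h0.ne (by linarith)
      have e' : enetG X l2 y' θ' j = -l1 := mul_right_cancel₀ h0'.ne (by linarith)
      rw [abs_of_nonpos (by nlinarith), e, e']
      linear_combination (-l1 * (a * θ j + b * θ' j)) * hab
    · have h0' : θ' j = 0 := by rw [h0, sign_zero] at hsj; exact sign_eq_zero_iff.1 hsj.symm
      simp [h0, h0']
    · have h0' : 0 < θ' j := by rw [sign_pos h0] at hsj; exact sign_eq_one_iff.1 hsj.symm
      rw [abs_of_pos h0] at d
      rw [abs_of_pos h0'] at d'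
      have e : enetG X l2 y θ j = l1 := mul_right_cancel₀ h0.ne' (by linarith)
      have e' : enetG X l2 y' θ' j = l1 := mul_right_cancel₀ h0'.ne' (by linarith)
      rw [abs_of_nonneg (by positivity), e, e']
      linear_combination (l1 * (a * θ j + b * θ' j)) * hab

/-- (Lemma 5: local constancy of the active set and sign vector.)  For a fixed
design matrix `X` and `(λ₁, λ₂) ∈ (0,∞)²`, there is a Lebesgue-null set `𝒩 ⊆ ℝ^N` such that for
every `y* ∉ 𝒩` the sign vector of `θ̂_{λ₁,λ₂}(y)` is constant for `y` in a neighborhood of `y*`;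
in particular the active set is locally constant off `𝒩`. -/
theorem stmt12
    (N p : ℕ) (X : Matrix (Fin N) (Fin p) ℝ)
    (l1 l2 : ℝ) (hl1 : 0 < l1) (hl2 : 0 < l2)
    (θhat : (Fin N → ℝ) → (Fin p → ℝ))
    (hmin : ∀ y : Fin N → ℝ, ∀ θ : Fin p → ℝ,
      (∑ i, (y i - ∑ j, X i j * θhat y j) ^ 2)
          + l1 * (∑ j, |θhat y j|) + l2 * (∑ j, θhat y j ^ 2)
        ≤ (∑ i, (y i - ∑ j, X i j * θ j) ^ 2)
          + l1 * (∑ j, |θ j|) + l2 * (∑ j, θ j ^ 2)) :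
    ∃ 𝒩 : Set (Fin N → ℝ), volume 𝒩 = 0 ∧
      ∀ ystar : Fin N → ℝ, ystar ∉ 𝒩 →
        ∃ ε > (0:ℝ), ∀ y : Fin N → ℝ, dist y ystar < ε →
          (((fun j => Real.sign (θhat y j)) = fun j => Real.sign (θhat ystar j))
            ∧ {j : Fin p | θhat y j ≠ 0} = {j : Fin p | θhat ystar j ≠ 0}) := by
  have hK : ∀ y, enetK X l1 l2 y (θhat y) := fun y => enet_necessary X l1 l2 hl1 y _ (hmin y)
  let A : (Fin p → SignType) → Set (Fin N → ℝ) :=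
    fun s => {y | ∀ j, SignType.sign (θhat y j) = s j}
  have hA : ∀ s, Convex ℝ (A s) := by
    intro s y hy y' hy' a b ha hb hab j
    have hk := enet_K_convex X l1 l2 y y' (θhat y) (θhat y') a b ha hb hab
      (fun j => (hy j).trans (hy' j).symm) (hK y) (hK y')
    have he := enet_unique X l1 l2 hl2 _ _ _ (hK (a • y + b • y')) hk
    rw [he]
    exact enet_sign_convex _ _ _ _ _ ha hb hab (hy j) (hy' j)
  refine ⟨⋃ s, frontier (A s), ?_, ?_⟩
  · rw [measure_iUnion_null_iff]
    exact fun s => (hA s).addHaar_frontier volume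
  · intro ystar hystar
    have hmem : ystar ∈ A (fun j => SignType.sign (θhat ystar j)) := fun j => rfl
    have hint : ystar ∈ interior (A (fun j => SignType.sign (θhat ystar j))) := by
      by_contra hc
      exact hystar (Set.mem_iUnion.2 ⟨_, subset_closure hmem, hc⟩)
    obtain ⟨ε, hε, hball⟩ := Metric.mem_nhds_iff.1 (mem_interior_iff_mem_nhds.1 hint)
    refine ⟨ε, hε, fun y hy => ?_⟩
    have hs : ∀ j, SignType.sign (θhat y j) = SignType.sign (θhat ystar j) := hball hy
    constructor
    · funext j
      have hj := hs j
      rcases lt_trichotomy (θhat ystar j) 0 with h0 | h0 | h0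
      · rw [sign_neg h0] at hj
        rw [Real.sign_of_neg h0, Real.sign_of_neg (sign_eq_neg_one_iff.1 hj)]
      · rw [h0, sign_zero] at hj
        rw [h0, sign_eq_zero_iff.1 hj]
      · rw [sign_pos h0] at hj
        rw [Real.sign_of_pos h0, Real.sign_of_pos (sign_eq_one_iff.1 hj)]
    · ext j
      simp only [Set.mem_ofPred_eq]
      rw [← sign_ne_zero, hs j, sign_ne_zero]
end

section
/- (Transition-point equation defines a null hyperplane in the response; core of Lemmas 2 and 3.) Fix λ₁ > 0, λ₂ > 0, a design matrix X ∈ ℝ^{N×p} with columns x_{·1},…,x_{·p}, a subset 𝒥 ⊆ {1,…,p}, a sign vector s ∈ {−1,1}^{𝒥}, and j* ∈ 𝒥 with column x_{·j*} ≠ 0. Let X_𝒥 be the submatrix of X with columns in 𝒥, G := X_𝒥ᵀX_𝒥, and e_{j*} the coordinate unit vector of index j* in ℝ^{𝒥}. Then the vector a := X_𝒥 (G + λ₂ I)^{-1} e_{j*} ∈ ℝ^N is nonzero, so the set {y ∈ ℝ^N : e_{j*}ᵀ (G + λ₂ I)^{-1} (X_𝒥ᵀ y − (λ₁/2) s) =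 0} is an affine hyperplane in ℝ^N and hence has Lebesgue measure zero. -/
open MeasureTheory Matrix
open scoped BigOperators

theorem aux_hyperplane {N : ℕ} (a : Fin N → ℝ) (ha : a ≠ 0) (c : ℝ) :
    volume {y : Fin N → ℝ | a ⬝ᵥ y = c} = 0 := by
  let S : AffineSubspace ℝ (Fin N → ℝ) :=
    { carrier := {y | a ⬝ᵥ y = c}
      smul_vsub_vadd_mem' := by
        intro r y1 y2 y3 h1 h2 h3
        simp only [Set.mem_setOf_eq, vsub_eq_sub, vadd_eq_add, dotProduct_add, dotProduct_smul,
          dotProduct_sub] at *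
        rw [h1, h2, h3]; simp }
  have hS : S ≠ ⊤ := by
    intro h
    have key : ∀ y : Fin N → ℝ, a ⬝ᵥ y = c := by
      intro y
      have : y ∈ S := by rw [h]; trivial
      exact this
    have h0 := key 0
    rw [dotProduct_zero] at h0
    have h1 := key a
    rw [← h0] at h1
    exact ha (dotProduct_self_eq_zero.mp h1)
  exact Measure.addHaar_affineSubspace volume S hS

/-- (Transition-point equation defines a null hyperplane in the response.)
For `λ₁, λ₂ > 0`, a design matrix `X`, an index set `𝒥`, a sign vector `s ∈ {−1,1}^𝒥` and
`j* ∈ 𝒥` whose column `x_{·j*}` is nonzero, the vector `a := X_𝒥 (G + λ₂I)⁻¹ e_{j*}` is nonzero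
(where `G := X_𝒥ᵀ X_𝒥`), and the set
`{y : e_{j*}ᵀ (G + λ₂I)⁻¹ (X_𝒥ᵀ y − (λ₁/2)s) = 0}` has Lebesgue measure zero. -/
theorem stmt14
    (N p : ℕ) (X : Matrix (Fin N) (Fin p) ℝ)
    (l1 l2 : ℝ) (hl1 : 0 < l1) (hl2 : 0 < l2)
    (J : Finset (Fin p)) (s : {j : Fin p // j ∈ J} → ℝ)
    (hs : ∀ a, s a = 1 ∨ s a = -1)
    (jstar : Fin p) (hjstar : jstar ∈ J)
    (hcol : (fun i : Fin N => X i jstar) ≠ 0)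
    (XJ : Matrix (Fin N) {j : Fin p // j ∈ J} ℝ)
    (hXJ : XJ = Matrix.of fun i a => X i a.1)
    (G : Matrix {j : Fin p // j ∈ J} {j : Fin p // j ∈ J} ℝ)
    (hG : G = XJᵀ * XJ) :
    XJ *ᵥ ((G + l2 • 1)⁻¹ *ᵥ Pi.single ⟨jstar, hjstar⟩ 1) ≠ 0 ∧
    volume {y : Fin N → ℝ |
      Pi.single (⟨jstar, hjstar⟩ : {j : Fin p // j ∈ J}) (1:ℝ)
          ⬝ᵥ ((G + l2 • 1)⁻¹ *ᵥ (XJᵀ *ᵥ y - (l1 / 2) • s)) = 0} = 0 := by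
  have hGs : Gᵀ = G := by rw [hG]; simp
  have hpd : (G + l2 • 1).PosDef := by
    have h1 : G.PosSemidef := by
      rw [hG]
      simpa [conjTranspose_eq_transpose_of_trivial] using posSemidef_conjTranspose_mul_self XJ
    exact PosDef.posSemidef_add h1 (PosDef.one.smul hl2)
  have hu : IsUnit (G + l2 • 1).det := hpd.det_pos.ne'.isUnit
  have ha : XJ *ᵥ ((G + l2 • 1)⁻¹ *ᵥ Pi.single ⟨jstar, hjstar⟩ 1) ≠ 0 := by
    intro h
    set v := (G + l2 • 1)⁻¹ *ᵥ (Pi.single ⟨jstar, hjstar⟩ 1 : {j : Fin p // j ∈ J} → ℝ) with hv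
    have h1 : (G + l2 • 1) *ᵥ v = Pi.single ⟨jstar, hjstar⟩ 1 := by
      rw [hv, mulVec_mulVec, mul_nonsing_inv _ hu, one_mulVec]
    have h2 : G *ᵥ v = 0 := by
      rw [hG, ← mulVec_mulVec, h, mulVec_zero]
    rw [add_mulVec, h2, zero_add, smul_mulVec, one_mulVec] at h1
    have h3 : XJ *ᵥ (Pi.single ⟨jstar, hjstar⟩ 1) = 0 := by
      rw [← h1, mulVec_smul, h, smul_zero]
    apply hcol
    rw [← h3, hXJ]
    ext i
    simp
  refine ⟨ha, ?_⟩
  have hsym : ((G + l2 • 1)⁻¹)ᵀ = (G + l2 • 1)⁻¹ := by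
    rw [transpose_nonsing_inv]
    simp [hGs]
  convert aux_hyperplane _ ha (Pi.single (⟨jstar, hjstar⟩ : {j : Fin p // j ∈ J}) (1:ℝ)
          ⬝ᵥ ((G + l2 • 1)⁻¹ *ᵥ ((l1 / 2) • s))) using 3
  ext y
  have e : XJ *ᵥ ((G + l2 • 1)⁻¹ *ᵥ Pi.single ⟨jstar, hjstar⟩ 1) ⬝ᵥ y =
      Pi.single (⟨jstar, hjstar⟩ : {j : Fin p // j ∈ J}) (1:ℝ)
          ⬝ᵥ ((G + l2 • 1)⁻¹ *ᵥ (XJᵀ *ᵥ y)) := by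
    rw [dotProduct_mulVec _ (G + l2 • 1)⁻¹, ← mulVec_transpose, hsym, dotProduct_mulVec _ XJᵀ,
      ← mulVec_transpose, transpose_transpose]
  rw [e, mulVec_sub, dotProduct_sub, sub_eq_zero]
end
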